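/- In the digraph H_k (k ≥ 3), the vertices f_v, f_u, f_w are exactly the sinks of H_k, and the set {f_v, f_u, f_w} (k−1)-absorbs every vertex of H_k except v_1, u_1 and w_1; that is, for every vertex x ∉ {v_1, u_1, w_1, f_v, f_u, f_w} there exists s ∈ {f_v, f_u, f_w} with d(x, s) ≤ k−1, while d(y, s) > k−1 for every y ∈ {v_1, u_1, w_1} and every s ∈ {f_v, f_u, f_w}. -/

import Mathlib

open List

attribute [local instance] Classical.propDecidable

variable {V : Type*}

/-- `l` is the vertex list of a directed path from `u` to `v` in the digraph with arc
relation `A`: the vertices are pairwise distinct, consecutive vertices are joined by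
arcs, the path starts at `u` and ends at `v`.  Its length (number of arcs) is
`l.length - 1`. -/
def IsPath (A : V → V → Prop) (u v : V) (l : List V) : Prop :=
  l.Nodup ∧ l.Chain' A ∧ l.head? = some u ∧ l.getLast? = some v

/-- The arcs of a directed path given by its vertex list. -/
def pathArcs (l : List V) : List (V × V) := l.zip l.tail

/-- The distance from `u` to `v` in the digraph with arc relation `A`: the least number
of arcs on a directed `uv`-path, and `⊤` if there is no such path. -/
noncomputable def ddist (A : V → V → Prop) (u v : V) : ℕ∞ :=
  sInf {n : ℕ∞ | ∃ l : List V, IsPath A u v l ∧ (l.length : ℕ∞) = n + 1}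

/-- The arcs of the directed cycle whose vertex list is `l` (consecutive pairs,
including the wrap-around arc from the last vertex to the first). -/
def cycleArcs (l : List V) : List (V × V) := l.zip (l.rotate 1)

/-- `l` is the vertex list of a directed cycle of the digraph with arc relation `A`;
the length `‖l‖` of the cycle is `l.length`. -/
def IsCycle (A : V → V → Prop) (l : List V) : Prop :=
  2 ≤ l.length ∧ l.Nodup ∧ ∀ p ∈ cycleArcs l, A p.1 p.2

/-- The number of symmetric arcs of the cycle with vertex list `l`. -/
noncomputable def symCount (A : V → V → Prop) (l : List V) : ℕ :=
  (cycleArcs l).countP (fun p => decide (A p.2 p.1))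

/-- The `m`-closure of a digraph: there is an arc from `u` to `v` iff `u ≠ v` and the
distance from `u` to `v` in `D` is at most `m`. -/
def mClosure (A : V → V → Prop) (m : ℕ) : V → V → Prop :=
  fun u v => u ≠ v ∧ ddist A u v ≤ (m : ℕ∞)

/-- A set `S` is `k`-independent if the distance between any two distinct vertices of
`S` is at least `k`. -/
def KIndependent (A : V → V → Prop) (k : ℕ) (S : Set V) : Prop :=
  ∀ u ∈ S, ∀ v ∈ S, u ≠ v → (k : ℕ∞) ≤ ddist A u v

/-- A set `S` is `ℓ`-absorbent if every vertex outside `S` is at distance at most `ℓ`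
from some vertex of `S`. -/
def LAbsorbent (A : V → V → Prop) (ℓ : ℕ) (S : Set V) : Prop :=
  ∀ u, u ∉ S → ∃ v ∈ S, ddist A u v ≤ (ℓ : ℕ∞)

/-- A `k`-kernel is a `k`-independent and `(k-1)`-absorbent set. -/
def IsKKernel (A : V → V → Prop) (k : ℕ) (S : Set V) : Prop :=
  KIndependent A k S ∧ LAbsorbent A (k - 1) S

/-- A kernel is a `2`-kernel, i.e. an independent set that `1`-absorbs every vertex
outside of it. -/
def IsKernel (A : V → V → Prop) (S : Set V) : Prop := IsKKernel A 2 S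

/-- A digraph is kernel-perfect if every induced subdigraph has a kernel. -/
def KernelPerfect (A : V → V → Prop) : Prop :=
  ∀ S : Set V, ∃ K : Set S, IsKernel (fun x y : S => A x.1 y.1) K
/-- The vertex set of the digraph `H_k`: three copies `v`, `u`, `w` of `{1, …, k-1}`
(indexed here by `Fin (k-1)`, with `i : Fin (k-1)` standing for the vertex with
subscript `i+1`), together with the six extra vertices `e_v, f_v, e_u, f_u, e_w, f_w`. -/
inductive HkV (k : ℕ) : Type
  | vv (i : Fin (k - 1)) : HkV k
  | uu (i : Fin (k - 1)) : HkV k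
  | ww (i : Fin (k - 1)) : HkV k
  | ev : HkV k
  | fv : HkV k
  | eu : HkV k
  | fu : HkV k
  | ew : HkV k
  | fw : HkV k

/-- The arc relation of the digraph `H_k`: the symmetric arcs between consecutive
vertices of each of the three paths, the arcs `(v_{k-1}, u_1)`, `(u_{k-1}, w_1)`,
`(w_{k-1}, v_1)`, and the pendant arcs `(s_{k-1}, e_s)`, `(e_s, f_s)` for
`s ∈ {v, u, w}`. -/
def HkAdj (k : ℕ) : HkV k → HkV k → Prop
  | .vv i, .vv j => j.val = i.val + 1 ∨ i.val = j.val + 1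
  | .uu i, .uu j => j.val = i.val + 1 ∨ i.val = j.val + 1
  | .ww i, .ww j => j.val = i.val + 1 ∨ i.val = j.val + 1
  | .vv i, .uu j => i.val = k - 2 ∧ j.val = 0
  | .uu i, .ww j => i.val = k - 2 ∧ j.val = 0
  | .ww i, .vv j => i.val = k - 2 ∧ j.val = 0
  | .vv i, .ev => i.val = k - 2
  | .uu i, .eu => i.val = k - 2
  | .ww i, .ew => i.val = k - 2
  | .ev, .fv => True
  | .eu, .fu => True
  | .ew, .fw => True
  | _, _ => False

/-- The distance to the nearest sink. -/
def hkPot (k : ℕ) : HkV k → ℕ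
  | .vv i => k - i.val
  | .uu i => k - i.val
  | .ww i => k - i.val
  | .ev => 1
  | .eu => 1
  | .ew => 1
  | .fv => 0
  | .fu => 0
  | .fw => 0

lemma hkPot_adj (k : ℕ) (hk : 3 ≤ k) (x y : HkV k) (h : HkAdj k x y) :
    hkPot k x ≤ hkPot k y + 1 := by
  cases x <;> cases y <;> simp only [HkAdj, hkPot] at h ⊢ <;> omega

lemma hkPot_zero (k : ℕ) (x : HkV k) :
    hkPot k x = 0 ↔ x ∈ ({HkV.fv, HkV.fu, HkV.fw} : Set (HkV k)) := by
  cases x <;> simp [hkPot] <;> omega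

lemma hkPot_step (k : ℕ) (hk : 3 ≤ k) (x : HkV k) (h : hkPot k x ≠ 0) :
    ∃ y, HkAdj k x y ∧ hkPot k y + 1 = hkPot k x := by
  cases x with
  | vv i =>
    by_cases hi : i.val = k - 2
    · exact ⟨.ev, hi, by simp only [hkPot]; omega⟩
    · exact ⟨.vv ⟨i.val + 1, by omega⟩, Or.inl rfl, by simp only [hkPot]; omega⟩
  | uu i =>
    by_cases hi : i.val = k - 2
    · exact ⟨.eu, hi, by simp only [hkPot]; omega⟩
    · exact ⟨.uu ⟨i.val + 1, by omega⟩, Or.inl rfl, by simp only [hkPot]; omega⟩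
  | ww i =>
    by_cases hi : i.val = k - 2
    · exact ⟨.ew, hi, by simp only [hkPot]; omega⟩
    · exact ⟨.ww ⟨i.val + 1, by omega⟩, Or.inl rfl, by simp only [hkPot]; omega⟩
  | ev => exact ⟨.fv, trivial, rfl⟩
  | eu => exact ⟨.fu, trivial, rfl⟩
  | ew => exact ⟨.fw, trivial, rfl⟩
  | fv => exact absurd rfl h
  | fu => exact absurd rfl h
  | fw => exact absurd rfl h

lemma hk_path (k : ℕ) (hk : 3 ≤ k) (n : ℕ) : ∀ x : HkV k, hkPot k x = n →
    ∃ s ∈ ({HkV.fv, HkV.fu, HkV.fw} : Set (HkV k)), ∃ l : List (HkV k),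
      IsPath (HkAdj k) x s l ∧ l.length = n + 1 ∧ ∀ z ∈ l, hkPot k z ≤ n := by
  induction n with
  | zero =>
    intro x hx
    refine ⟨x, (hkPot_zero k x).1 hx, [x], ?_, rfl, ?_⟩
    · simp [IsPath, List.Chain']
    · simp [hx]
  | succ n ih =>
    intro x hx
    obtain ⟨y, hxy, hy⟩ := hkPot_step k hk x (by omega)
    obtain ⟨s, hs, l, ⟨hnd, hch, hhd, hlast⟩, hlen, hall⟩ := ih y (by omega)
    refine ⟨s, hs, x :: l, ⟨?_, ?_, rfl, ?_⟩, by simp [hlen], ?_⟩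
    · refine List.nodup_cons.2 ⟨fun hm => ?_, hnd⟩
      have := hall x hm
      omega
    · cases l with
      | nil => simp at hhd
      | cons a t =>
        simp only [List.head?_cons, Option.some.injEq] at hhd
        subst hhd
        exact List.isChain_cons_cons.2 ⟨hxy, hch⟩
    · cases l with
      | nil => simp at hhd
      | cons a t => simpa [List.getLast?_cons_cons] using hlast
    · intro z hz
      rcases List.mem_cons.1 hz with rfl | hz
      · omega
      · have := hall z hz
        omega

lemma hk_lower (k : ℕ) (hk : 3 ≤ k) (s : HkV k) (hs : hkPot k s = 0) (l : List (HkV k)) :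
    ∀ x : HkV k, List.IsChain (HkAdj k) l → l.head? = some x → l.getLast? = some s →
      hkPot k x + 1 ≤ l.length := by
  induction l with
  | nil => simp
  | cons a t ih =>
    intro x hch hhd hl
    simp only [List.head?_cons, Option.some.injEq] at hhd
    subst hhd
    cases t with
    | nil =>
      simp only [List.getLast?_singleton, Option.some.injEq] at hl
      subst hl
      simp [hs]
    | cons b t =>
      obtain ⟨h1, h2⟩ := List.isChain_cons_cons.1 hch
      have := ih b h2 rfl (by simpa [List.getLast?_cons_cons] using hl)
      have := hkPot_adj k hk _ _ h1
      simp only [List.length_cons] at *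
      omega

/-- In `H_k` (`k ≥ 3`), the vertices `f_v, f_u, f_w` are exactly the sinks, and the set
`{f_v, f_u, f_w}` `(k-1)`-absorbs every vertex of `H_k` except `v_1`, `u_1` and `w_1`:
every vertex `x ∉ {v_1, u_1, w_1, f_v, f_u, f_w}` is at distance at most `k-1` from
some `s ∈ {f_v, f_u, f_w}`, while `d(y, s) > k-1` for every `y ∈ {v_1, u_1, w_1}` and
every `s ∈ {f_v, f_u, f_w}`. -/
theorem Hk_sinks (k : ℕ) (hk : 3 ≤ k) :
    (∀ x : HkV k, (∀ y : HkV k, ¬ HkAdj k x y) ↔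
      x ∈ ({HkV.fv, HkV.fu, HkV.fw} : Set (HkV k))) ∧
    (∀ x : HkV k,
      x ∉ ({HkV.vv ⟨0, by omega⟩, HkV.uu ⟨0, by omega⟩, HkV.ww ⟨0, by omega⟩,
            HkV.fv, HkV.fu, HkV.fw} : Set (HkV k)) →
      ∃ s ∈ ({HkV.fv, HkV.fu, HkV.fw} : Set (HkV k)),
        ddist (HkAdj k) x s ≤ ((k - 1 : ℕ) : ℕ∞)) ∧
    (∀ y ∈ ({HkV.vv ⟨0, by omega⟩, HkV.uu ⟨0, by omega⟩,
             HkV.ww ⟨0, by omega⟩} : Set (HkV k)),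
      ∀ s ∈ ({HkV.fv, HkV.fu, HkV.fw} : Set (HkV k)),
        ((k - 1 : ℕ) : ℕ∞) < ddist (HkAdj k) y s) := by
  refine ⟨fun x => ?_, fun x hx => ?_, fun y hy s hs => ?_⟩
  · rw [← hkPot_zero]
    constructor
    · intro h
      by_contra h0
      obtain ⟨y, hy, -⟩ := hkPot_step k hk x h0
      exact h y hy
    · intro h y hy
      cases x <;> simp only [hkPot] at h <;> first | omega | simp [HkAdj] at hy
  · obtain ⟨s, hs, l, hl, hlen, -⟩ := hk_path k hk _ x rfl
    refine ⟨s, hs, ?_⟩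
    have h1 : ddist (HkAdj k) x s ≤ (hkPot k x : ℕ∞) :=
      sInf_le ⟨l, hl, by rw [hlen]; push_cast; rfl⟩
    refine h1.trans ?_
    have h2 : hkPot k x ≤ k - 1 := by
      cases x <;> simp [Fin.ext_iff] at hx <;> simp only [hkPot] <;> omega
    exact_mod_cast h2
  · have hp : hkPot k y = k := by
      rcases hy with rfl | rfl | rfl <;> simp [hkPot]
    have h1 : (k : ℕ∞) ≤ ddist (HkAdj k) y s := by
      refine le_sInf ?_
      rintro n ⟨l, ⟨-, hch, hhd, hl⟩, hn⟩
      have h3 := hk_lower k hk s ((hkPot_zero k s).2 hs) l y hch hhd hl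
      rw [hp] at h3
      have h4 : ((k + 1 : ℕ) : ℕ∞) ≤ n + 1 := by
        rw [← hn]
        exact_mod_cast h3
      cases n with
      | top => exact le_top
      | coe n =>
        have h5 : k + 1 ≤ n + 1 := by exact_mod_cast h4
        have h6 : k ≤ n := by omega
        exact_mod_cast h6
    refine lt_of_lt_of_le ?_ h1
    have h7 : k - 1 < k := by omega
    exact_mod_cast h7
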